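/- The plane EuclideanSpace ℝ (Fin 2) (equivalently, the open disk) admits no circle decomposition. -/

import Mathlib

open Topology Set

/-- A circle in a topological space `X`: a subset homeomorphic to the unit circle. -/
def IsCircle {X : Type*} [TopologicalSpace X] (C : Set X) : Prop :=
  Nonempty (C ≃ₜ Circle)

/-- A circle decomposition of `X`: a set of pairwise disjoint circles whose union is `X`. -/
def IsCircleDecomposition {X : Type*} [TopologicalSpace X] (𝒞 : Set (Set X)) : Prop :=
  (∀ C ∈ 𝒞, IsCircle C) ∧
  (∀ C ∈ 𝒞, ∀ D ∈ 𝒞, C ≠ D → Disjoint C D) ∧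
  ⋃₀ 𝒞 = Set.univ

open Complex unitInterval in
theorem exists_log_sub_div_sub (γ : C(I, ℂ)) :
    ∃ g : ℂ → ℂ, ContinuousOn g (range γ)ᶜ ∧
      ∀ z ∉ range γ, exp (g z) = (z - γ 1) / (z - γ 0) := by
  classical
  have hne (z : ((range γ)ᶜ : Set ℂ)) (t : I) : (z : ℂ) - γ t ≠ 0 :=
    sub_ne_zero.2 fun h ↦ z.2 ⟨t, h.symm⟩
  let H : C(I × ((range γ)ᶜ : Set ℂ), {z : ℂ // z ≠ 0}) :=
    ⟨fun x ↦ ⟨(x.2 - γ x.1) / (x.2 - γ 0), div_ne_zero (hne _ _) (hne _ _)⟩, by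
      refine Continuous.subtype_mk (Continuous.div (by fun_prop) (by fun_prop) ?_) _
      exact fun x ↦ hne _ _⟩
  have H0 (z) : H (0, z) = ⟨exp ((ContinuousMap.const _ (0 : ℂ)) z), exp_ne_zero _⟩ := by
    ext
    simp [H, div_self (hne z 0)]
  let G := isCoveringMap_exp.liftHomotopy H (.const _ 0) H0
  have hG (z) : exp (G (1, z)) = (z - γ 1) / (z - γ 0) :=
    congrArg Subtype.val (congrFun (isCoveringMap_exp.liftHomotopy_lifts H (.const _ 0) H0) (1, z))
  refine ⟨fun z ↦ if hz : z ∈ (range γ)ᶜ then G (1, ⟨z, hz⟩) else 0, ?_, fun z hz ↦ ?_⟩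
  · rw [continuousOn_iff_continuous_domRestrict]
    convert (by fun_prop : Continuous fun z ↦ G (1, z)) using 1
    ext z
    simp [domRestrict]
  · have hz' : z ∈ (range γ)ᶜ := hz
    simp only [dif_pos hz', hG]

theorem Complex.eq_of_exp_comp_eq_const {X : Type*} [TopologicalSpace X] {s : Set X} {c : ℂ}
    (hs : IsPreconnected s) {g : X → ℂ} (hg : ContinuousOn g s)
    (h : ∀ x ∈ s, Complex.exp (g x) = c) {x y : X} (hx : x ∈ s) (hy : y ∈ s) : g x = g y := by
  refine Complex.isCoveringMap_exp.constOn_of_comp hs hg (fun a ha b hb ↦ ?_) hx hy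
  exact Subtype.ext ((h a ha).trans (h b hb).symm)

open Complex in
theorem not_exists_log_sub_div_sub {p q : ℂ} (hpq : p ≠ q) :
    ¬ ∃ g : ℂ → ℂ, ContinuousOn g ({p, q}ᶜ) ∧
      ∀ z ∉ ({p, q} : Set ℂ), exp (g z) = (z - q) / (z - p) := by
  rintro ⟨g, hg, hexp⟩
  have hd : p - q ≠ 0 := sub_ne_zero.2 hpq
  set w : ℝ → ℂ := fun θ ↦ (p - q) / 2 * exp (θ * I) with hw
  have hwc : Continuous w := by fun_prop
  have hw0 (θ) : w θ ≠ 0 := mul_ne_zero (div_ne_zero hd two_ne_zero) (exp_ne_zero _)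
  have hslit (θ : ℝ) : 1 + exp (θ * I) / 2 ∈ slitPlane := by
    apply mem_slitPlane_of_norm_lt_one
    rw [norm_div, norm_exp_ofReal_mul_I]
    norm_num
  have hwq (θ : ℝ) : p + w θ - q = (p - q) * (1 + exp (θ * I) / 2) := by
    simp only [hw]; ring
  have hmem (θ) : p + w θ ∉ ({p, q} : Set ℂ) := by
    have h := mul_ne_zero hd (slitPlane_ne_zero (hslit θ))
    rw [← hwq, sub_ne_zero] at h
    simp [hw0 θ, h]
  let h : ℝ → ℂ := fun θ ↦ g (p + w θ) - log (1 + exp (θ * I) / 2) + θ * I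
  have hc : Continuous h := by
    refine Continuous.add (Continuous.sub ?_ ?_) (by fun_prop)
    · exact hg.comp_continuous (by fun_prop) hmem
    · exact Continuous.clog (by fun_prop) hslit
  have he (θ) : exp (h θ) = 2 := by
    have h1 := slitPlane_ne_zero (hslit θ)
    have h3 : 2 + exp (θ * I) ≠ 0 := by
      rw [show 2 + exp (θ * I) = 2 * (1 + exp (θ * I) / 2) by ring]
      exact mul_ne_zero two_ne_zero h1
    have h2 := exp_ne_zero (θ * I)
    simp only [h]
    rw [exp_add, exp_sub, exp_log h1, hexp _ (hmem θ), hwq, add_sub_cancel_left]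
    simp only [hw]
    field_simp
  have := Complex.eq_of_exp_comp_eq_const isPreconnected_univ hc.continuousOn (fun θ _ ↦ he θ)
    (mem_univ 0) (mem_univ (2 * Real.pi))
  simp [h, hw, exp_two_pi_mul_I] at this

open unitInterval in
theorem IsCircle.exists_arcs {X : Type*} [TopologicalSpace X] {C : Set X} (hC : IsCircle C) :
    ∃ α β : C(I, X), α 0 = β 0 ∧ α 1 = β 1 ∧ α 0 ≠ α 1 ∧
      range α ∪ range β = C ∧ range α ∩ range β ⊆ {α 0, α 1} := by
  obtain ⟨e⟩ := hC
  have hinj : Function.Injective fun z : Circle ↦ (e.symm z : X) :=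
    Subtype.val_injective.comp e.symm.injective
  let α (c : ℝ) : C(I, X) := ⟨fun t ↦ e.symm (Circle.exp (c * t)), by fun_prop⟩
  have hpi := Real.pi_pos
  refine ⟨α Real.pi, α (-Real.pi), by simp [α], ?_, fun h ↦ ?_, ?_, ?_⟩
  · simp only [α, ContinuousMap.coe_mk]
    congr 2
    ext
    simp
  · have := congrArg Subtype.val (hinj h)
    norm_num [Circle.coe_exp] at this
  · refine Subset.antisymm ?_ fun x hx ↦ ?_
    · rintro _ (⟨t, rfl⟩ | ⟨t, rfl⟩) <;> exact Subtype.coe_prop _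
    · have harg := Circle.exp_arg (e ⟨x, hx⟩)
      set θ := Complex.arg (e ⟨x, hx⟩)
      have h1 : -Real.pi < θ := Complex.neg_pi_lt_arg _
      have h2 : θ ≤ Real.pi := Complex.arg_le_pi _
      rcases le_total 0 θ with h | h
      · refine .inl ⟨⟨θ / Real.pi, by positivity, by rw [div_le_one hpi]; exact h2⟩, ?_⟩
        simp [α, mul_div_cancel₀ _ hpi.ne', harg]
      · refine .inr ⟨⟨-θ / Real.pi, div_nonneg (by linarith) hpi.le, by
          rw [div_le_one hpi]; linarith⟩, ?_⟩
        have : -Real.pi * (-θ / Real.pi) = θ := by field_simp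
        simp only [α, ContinuousMap.coe_mk, this, harg, e.symm_apply_apply]
  · rintro _ ⟨⟨t, rfl⟩, s, hs⟩
    obtain ⟨n, hn⟩ := Circle.exp_eq_exp.1 (hinj hs)
    have hn' : (t : ℝ) + s = -2 * n := by
      have : Real.pi * (t + s) = Real.pi * (-2 * n) := by linarith
      exact mul_left_cancel₀ hpi.ne' this
    have h0 := add_nonneg t.2.1 s.2.1
    have h2 := add_le_add t.2.2 s.2.2
    rw [hn'] at h0 h2
    have hn0 : n ≤ 0 := by
      have : (n : ℝ) ≤ 0 := by linarith
      exact_mod_cast this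
    have hn1 : -1 ≤ n := by
      have : (-1 : ℝ) ≤ n := by linarith
      exact_mod_cast this
    have hcases : t = 0 ∨ t = 1 := by
      have ht := t.2
      have hs := s.2
      obtain rfl | rfl : n = 0 ∨ n = -1 := by omega
      · refine .inl (Subtype.ext (le_antisymm ?_ ht.1))
        push_cast at hn'
        simp only [Icc.coe_zero]
        linarith [hs.1]
      · refine .inr (Subtype.ext (le_antisymm ht.2 ?_))
        push_cast at hn'
        simp only [Icc.coe_one]
        linarith [hs.2]
    rcases hcases with rfl | rfl <;> simp

theorem IsCircle.isCompact {X : Type*} [TopologicalSpace X] {C : Set X} (hC : IsCircle C) :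
    IsCompact C := by
  obtain ⟨e⟩ := hC
  exact isCompact_iff_compactSpace.2 e.symm.compactSpace

theorem IsCircle.isConnected {X : Type*} [TopologicalSpace X] {C : Set X} (hC : IsCircle C) :
    IsConnected C := by
  obtain ⟨e⟩ := hC
  have : ConnectedSpace Circle :=
    Circle.exp_surjective.connectedSpace Circle.exp.continuous
  exact isConnected_iff_connectedSpace.2 (e.symm.surjective.connectedSpace e.symm.continuous)

/-- A weak form of the Jordan curve theorem. -/
theorem IsCircle.not_isPreconnected_compl {C : Set ℂ} (hC : IsCircle C) :
    ¬ IsPreconnected Cᶜ := by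
  classical
  intro hconn
  obtain ⟨α, β, h0, h1, hne, hunion, hinter⟩ := hC.exists_arcs
  obtain ⟨f, hf, hfexp⟩ := exists_log_sub_div_sub α
  obtain ⟨g, hg, hgexp⟩ := exists_log_sub_div_sub β
  rw [← h0, ← h1] at hgexp
  have hCc : Cᶜ = (range α)ᶜ ∩ (range β)ᶜ := by rw [← hunion, compl_union]
  have hα : IsOpen (range α)ᶜ := (isCompact_range α.continuous).isClosed.isOpen_compl
  have hβ : IsOpen (range β)ᶜ := (isCompact_range β.continuous).isClosed.isOpen_compl
  obtain ⟨c, hc, hcexp⟩ : ∃ c, (∀ z ∈ Cᶜ, f z = g z + c) ∧ Complex.exp c = 1 := by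
    have hexp : ∀ z ∈ Cᶜ, Complex.exp (f z - g z) = 1 := fun z hz ↦ by
      rw [hCc] at hz
      rw [Complex.exp_sub, hfexp z hz.1, hgexp z hz.2, div_self]
      rw [← hfexp z hz.1]
      exact Complex.exp_ne_zero _
    have hcont : ContinuousOn (fun z ↦ f z - g z) Cᶜ := by
      rw [hCc]
      exact (hf.mono inter_subset_left).sub (hg.mono inter_subset_right)
    obtain hempty | ⟨z, hz⟩ := (Cᶜ).eq_empty_or_nonempty
    · exact ⟨0, by simp [hempty], Complex.exp_zero⟩
    · refine ⟨f z - g z, fun y hy ↦ ?_, hexp z hz⟩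
      rw [← Complex.eq_of_exp_comp_eq_const hconn hcont hexp hy hz]
      ring
  refine not_exists_log_sub_div_sub hne ⟨fun z ↦ if z ∈ range α then g z + c else f z, ?_, ?_⟩
  · intro z hz
    refine ContinuousAt.continuousWithinAt ?_
    by_cases hzα : z ∈ range α
    · have hzβ : z ∈ (range β)ᶜ := fun h ↦ hz (hinter ⟨hzα, h⟩)
      refine ((hg.continuousAt (hβ.mem_nhds hzβ)).add_const c).congr ?_
      filter_upwards [hβ.mem_nhds hzβ] with y hy
      split_ifs with hyα
      · rfl
      · exact (hc y (hCc ▸ ⟨hyα, hy⟩)).symm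
    · refine (hf.continuousAt (hα.mem_nhds hzα)).congr ?_
      filter_upwards [hα.mem_nhds hzα] with y hy
      exact (if_neg hy).symm
  · intro z hz
    dsimp only
    split_ifs with hzα
    · have hzβ : z ∉ range β := fun h ↦ hz (hinter ⟨hzα, h⟩)
      rw [Complex.exp_add, hcexp, mul_one, hgexp z hzβ]
    · exact hfexp z hzα

/-- The points that can be joined to infinity by a connected set avoiding `C`. -/
def outerRegion (C : Set ℂ) : Set ℂ :=
  {z | ∃ S ⊆ Cᶜ, IsPreconnected S ∧ ¬ Bornology.IsBounded S ∧ z ∈ S}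

theorem outerRegion_subset_compl (C : Set ℂ) : outerRegion C ⊆ Cᶜ :=
  fun _ ⟨_, hS, _, _, hz⟩ ↦ hS hz

theorem subset_outerRegion {C S : Set ℂ} (hS : S ⊆ Cᶜ) (hc : IsPreconnected S)
    (hb : ¬ Bornology.IsBounded S) : S ⊆ outerRegion C :=
  fun _ hz ↦ ⟨S, hS, hc, hb, hz⟩

theorem subset_outerRegion_of_inter_nonempty {C T : Set ℂ} (hT : T ⊆ Cᶜ) (hc : IsPreconnected T)
    (h : (T ∩ outerRegion C).Nonempty) : T ⊆ outerRegion C := by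
  obtain ⟨z, hzT, S, hS, hSc, hSb, hzS⟩ := h
  exact subset_union_left.trans <| subset_outerRegion (union_subset hT hS)
    (hc.union z hzT hzS hSc) fun hb ↦ hSb (hb.subset subset_union_right)

theorem isOpen_outerRegion {C : Set ℂ} (hC : IsCompact C) : IsOpen (outerRegion C) := by
  refine Metric.isOpen_iff.2 fun z hz ↦ ?_
  obtain ⟨ε, hε, hball⟩ := Metric.isOpen_iff.1 hC.isClosed.isOpen_compl z
    (outerRegion_subset_compl C hz)
  exact ⟨ε, hε, subset_outerRegion_of_inter_nonempty hball Metric.isPreconnected_ball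
    ⟨z, Metric.mem_ball_self hε, hz⟩⟩

theorem isPreconnected_setOf_lt_norm (R : ℝ) :
    IsPreconnected {z : ℂ | R < ‖z‖} := by
  have : {z : ℂ | R < ‖z‖} =
      (fun x : ℝ × ℝ ↦ (x.1 : ℂ) * Complex.exp (x.2 * Complex.I)) '' (Ioi R ×ˢ univ) := by
    ext z
    constructor
    · exact fun hz ↦ ⟨(‖z‖, z.arg), ⟨hz, mem_univ _⟩, Complex.norm_mul_exp_arg_mul_I z⟩
    · rintro ⟨⟨r, θ⟩, ⟨hr, -⟩, rfl⟩
      simpa [Complex.norm_exp_ofReal_mul_I] using lt_of_lt_of_le hr (le_abs_self r)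
  rw [this]
  exact (isPreconnected_Ioi.prod isPreconnected_univ).image _ (by fun_prop)

theorem not_isBounded_of_ray {S : Set ℂ} (c : ℂ) (h : ∀ t : ℝ, 0 < t → c + t ∈ S) :
    ¬ Bornology.IsBounded S := by
  intro hb
  obtain ⟨R, hR⟩ := hb.exists_norm_le
  have h1 := hR _ (h (|R| + ‖c‖ + 1) (by positivity))
  have h2 := norm_sub_le (c + ((|R| + ‖c‖ + 1 : ℝ) : ℂ)) c
  rw [add_sub_cancel_left, Complex.norm_real, Real.norm_of_nonneg (by positivity)] at h2
  linarith [le_abs_self R]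

theorem exists_setOf_lt_norm_subset_outerRegion {C : Set ℂ} (hC : IsCompact C) :
    ∃ R : ℝ, 0 ≤ R ∧ {z : ℂ | R < ‖z‖} ⊆ outerRegion C := by
  obtain ⟨R, hR, hCR⟩ := hC.isBounded.exists_pos_norm_le
  refine ⟨R, hR.le, subset_outerRegion (fun z hz hzC ↦ (hCR z hzC).not_gt hz)
    (isPreconnected_setOf_lt_norm R) (not_isBounded_of_ray (R : ℂ) fun t ht ↦ ?_)⟩
  rw [mem_ofPred_eq, ← Complex.ofReal_add, Complex.norm_real, Real.norm_of_nonneg (by positivity)]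
  linarith

theorem isCompact_compl_outerRegion {C : Set ℂ} (hC : IsCompact C) :
    IsCompact (outerRegion C)ᶜ := by
  obtain ⟨R, -, hR⟩ := exists_setOf_lt_norm_subset_outerRegion hC
  refine Metric.isCompact_of_isClosed_isBounded (isOpen_outerRegion hC).isClosed_compl
    (isBounded_iff_forall_norm_le.2 ⟨R, fun z hz ↦ ?_⟩)
  by_contra! h
  exact hz (hR h)

theorem isPreconnected_outerRegion {C : Set ℂ} (hC : IsCompact C) :
    IsPreconnected (outerRegion C) := by
  obtain ⟨R, hR0, hR⟩ := exists_setOf_lt_norm_subset_outerRegion hC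
  have hw : ((R + 1 : ℝ) : ℂ) ∈ {z : ℂ | R < ‖z‖} := by
    rw [mem_ofPred_eq, Complex.norm_real, Real.norm_of_nonneg (by positivity)]
    linarith
  refine isPreconnected_of_forall ((R + 1 : ℝ) : ℂ) fun z ⟨S, hS, hSc, hSb, hz⟩ ↦ ?_
  obtain ⟨y, hyS, hy⟩ : ∃ y ∈ S, R < ‖y‖ := by
    by_contra! h
    exact hSb (isBounded_iff_forall_norm_le.2 ⟨R, h⟩)
  exact ⟨S ∪ {z | R < ‖z‖}, union_subset (subset_outerRegion hS hSc hSb) hR, .inr hw, .inl hz,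
    hSc.union y hyS hy (isPreconnected_setOf_lt_norm R)⟩

theorem IsCircle.exists_notMem_outerRegion {C : Set ℂ} (hC : IsCircle C) :
    ∃ z ∉ C, z ∉ outerRegion C := by
  by_contra! h
  refine hC.not_isPreconnected_compl ?_
  rw [← (outerRegion_subset_compl C).antisymm h]
  exact isPreconnected_outerRegion hC.isCompact

theorem setOf_lt_re_subset_outerRegion {C : Set ℂ} {m : ℝ} (hm : ∀ z ∈ C, z.re ≤ m) :
    {z : ℂ | m < z.re} ⊆ outerRegion C :=
  subset_outerRegion (fun z hz hzC ↦ (hm z hzC).not_gt hz)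
    (convex_halfSpace_re_gt m).isPreconnected
    (not_isBounded_of_ray (m : ℂ) fun t ht ↦ by simpa using ht)

/-- If a connected set `D` disjoint from `C` contains a point enclosed by `C`, then everything
enclosed by `D` is strictly enclosed by `C`. -/
theorem union_outerRegion_subset {C D : Set ℂ} (hC : IsCompact C) (hCc : IsConnected C)
    (hD : IsPreconnected D) (hCD : Disjoint C D) {x : ℂ} (hxD : x ∈ D) (hx : x ∉ outerRegion C) :
    C ∪ outerRegion C ⊆ outerRegion D := by
  have hdisj : outerRegion C ⊆ Dᶜ := fun z hz hzD ↦
    hx (subset_outerRegion_of_inter_nonempty hCD.subset_compl_left hD ⟨z, hzD, hz⟩ hxD)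
  refine union_subset ?_ fun z ⟨S, hS, hSc, hSb, hz⟩ ↦
    ⟨S, (subset_outerRegion hS hSc hSb).trans hdisj, hSc, hSb, hz⟩
  obtain ⟨c, hcC, hc⟩ := hC.exists_isMaxOn hCc.nonempty Complex.continuous_re.continuousOn
  have hray : ∀ t : ℝ, 0 < t → c + t ∈ outerRegion C := fun t ht ↦
    setOf_lt_re_subset_outerRegion (fun z hz ↦ hc hz) (by simpa using ht)
  let L : Set ℂ := (fun t : ℝ ↦ c + t) '' Ici 0
  have hcL : c ∈ L := ⟨0, self_mem_Ici, by simp⟩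
  have hL : L ⊆ C ∪ outerRegion C := by
    rintro _ ⟨t, ht, rfl⟩
    obtain rfl | ht := (mem_Ici.1 ht).eq_or_lt
    · left; simpa using hcC
    · exact .inr (hray t ht)
  have hLD : C ∪ L ⊆ Dᶜ :=
    union_subset hCD.subset_compl_right <| hL.trans (union_subset hCD.subset_compl_right hdisj)
  exact subset_union_left.trans <| subset_outerRegion hLD
    (hCc.isPreconnected.union c hcC hcL (isPreconnected_Ici.image _ (by fun_prop)))
    (not_isBounded_of_ray c fun t ht ↦ .inr ⟨t, ht.le, rfl⟩)

theorem not_isCircleDecomposition_complex (𝒞 : Set (Set ℂ)) : ¬ IsCircleDecomposition 𝒞 := by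
  rintro ⟨hcirc, hdisj, hcover⟩
  have hex (x : ℂ) : ∃ C ∈ 𝒞, x ∈ C := mem_sUnion.1 (hcover ▸ mem_univ x)
  have hsub {C D : Set ℂ} (hC : C ∈ 𝒞) (hD : D ∈ 𝒞) {x : ℂ} (hxD : x ∈ D)
      (hx : x ∉ outerRegion C) (hne : C ≠ D) : C ∪ outerRegion C ⊆ outerRegion D :=
    union_outerRegion_subset (hcirc C hC).isCompact (hcirc C hC).isConnected
      (hcirc D hD).isConnected.isPreconnected (hdisj C hC D hD hne) hxD hx
  obtain ⟨C₀, hC₀, -⟩ := hex 0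
  obtain ⟨M, hM⟩ : ∃ M, Maximal (· ∈ outerRegion '' 𝒞) M := by
    refine zorn_subset _ fun c hc hchain ↦ ?_
    obtain rfl | hne := c.eq_empty_or_nonempty
    · exact ⟨_, mem_image_of_mem _ hC₀, by simp⟩
    have : Nonempty c := hne.to_subtype
    have hcompact (U : c) : IsCompact (U : Set ℂ)ᶜ := by
      obtain ⟨C, hC, h⟩ := hc U.2
      exact h ▸ isCompact_compl_outerRegion (hcirc C hC).isCompact
    obtain ⟨x, hx⟩ := IsCompact.nonempty_iInter_of_directed_nonempty_isCompact_isClosed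
      (fun U : c ↦ (U : Set ℂ)ᶜ)
      (fun U V ↦ (hchain.total U.2 V.2).elim
        (fun h ↦ ⟨V, compl_subset_compl.2 h, Subset.rfl⟩)
        (fun h ↦ ⟨U, Subset.rfl, compl_subset_compl.2 h⟩))
      (fun U ↦ by
        obtain ⟨C, hC, h⟩ := hc U.2
        obtain ⟨z, -, hz⟩ := (hcirc C hC).exists_notMem_outerRegion
        exact ⟨z, h ▸ hz⟩)
      hcompact (fun U ↦ (hcompact U).isClosed)
    obtain ⟨D, hD, hxD⟩ := hex x
    refine ⟨_, mem_image_of_mem _ hD, fun U hU ↦ ?_⟩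
    obtain ⟨C, hC, rfl⟩ := hc hU
    obtain rfl | hCD := eq_or_ne C D
    · rfl
    · exact subset_union_right.trans (hsub hC hD hxD (mem_iInter.1 hx ⟨_, hU⟩) hCD)
  obtain ⟨⟨C, hC, rfl⟩, hmax⟩ := hM
  obtain ⟨x, hxC, hx⟩ := (hcirc C hC).exists_notMem_outerRegion
  obtain ⟨D, hD, hxD⟩ := hex x
  have hCD : C ∪ outerRegion C ⊆ outerRegion D :=
    hsub hC hD hxD hx fun h ↦ hxC (h ▸ hxD)
  obtain ⟨c, hc⟩ := (hcirc C hC).isConnected.nonempty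
  exact outerRegion_subset_compl C
    (hmax (mem_image_of_mem _ hD) (subset_union_right.trans hCD) (hCD (.inl hc))) hc

theorem IsCircle.image {X Y : Type*} [TopologicalSpace X] [TopologicalSpace Y] (e : X ≃ₜ Y)
    {C : Set X} (hC : IsCircle C) : IsCircle (e '' C) :=
  hC.map (e.image C).symm.trans

theorem IsCircleDecomposition.image {X Y : Type*} [TopologicalSpace X] [TopologicalSpace Y]
    (e : X ≃ₜ Y) {𝒞 : Set (Set X)} (h : IsCircleDecomposition 𝒞) :
    IsCircleDecomposition (image e '' 𝒞) := by
  obtain ⟨hcirc, hdisj, hcover⟩ := h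
  refine ⟨?_, ?_, ?_⟩
  · rintro _ ⟨C, hC, rfl⟩
    exact (hcirc C hC).image e
  · rintro _ ⟨C, hC, rfl⟩ _ ⟨D, hD, rfl⟩ hne
    exact (disjoint_image_iff e.injective).2 (hdisj C hC D hD fun h ↦ hne (h ▸ rfl))
  · rw [← image_sUnion, hcover, image_univ, e.surjective.range_eq]

/-- The plane (equivalently, the open disk) admits no circle decomposition. -/
theorem plane_no_circle_decomposition :
    ¬ ∃ 𝒞 : Set (Set (EuclideanSpace ℝ (Fin 2))), IsCircleDecomposition 𝒞 := by
  rintro ⟨𝒞, h𝒞⟩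
  exact not_isCircleDecomposition_complex _
    (h𝒞.image Complex.orthonormalBasisOneI.repr.symm.toHomeomorph)
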